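/- Let A : ℝ → ℝ be twice continuously differentiable with bounded second derivative. Then for every ξ > 0 and all u, v ∈ ℝ, |A^{β_ξ}(u,v) − A^{β_ξ}(v,u)| ≤ 2 ‖A''‖_∞ ξ |u − v|. -/

import Mathlib

open intervalIntegral

/-- The rescaled entropy function `β_ξ(r) = ξ β(r/ξ)`. -/
noncomputable def betaXi (β : ℝ → ℝ) (ξ : ℝ) : ℝ → ℝ := fun r => ξ * β (r / ξ)

/-- The entropy flux `A^{β_ξ}(a,b) := ∫_b^a β_ξ'(r − b) A'(r) dr`. -/
noncomputable def fluxBeta (β : ℝ → ℝ) (ξ : ℝ) (A : ℝ → ℝ) (a b : ℝ) : ℝ :=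
  ∫ r in b..a, deriv (betaXi β ξ) (r - b) * deriv A r

theorem beta_bounds (β : ℝ → ℝ) (hsmooth : ContDiff ℝ (⊤ : ℕ∞) β) (h0 : β 0 = 0)
    (heven : ∀ r, β (-r) = β r) (hconv : ∀ r, 0 ≤ deriv (deriv β) r)
    (hd1 : ∀ r, |deriv β r| ≤ 1)
    (hup : ∀ r : ℝ, 1 ≤ r → deriv β r = 1) (r : ℝ) : |r| - 1 ≤ β r ∧ β r ≤ |r| := by
  have hd : Differentiable ℝ β := hsmooth.differentiable (by simp)
  have hd2 : Differentiable ℝ (deriv β) := by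
    have h2 : ContDiff ℝ 2 β := contDiff_infty.1 hsmooth 2
    exact ((contDiff_succ_iff_deriv (n := 1)).1 h2).2.2.differentiable (by simp)
  have hc : ConvexOn ℝ Set.univ β :=
    convexOn_univ_of_deriv2_nonneg hd hd2 (fun x => by simpa using hconv x)
  have hpos : ∀ r, 0 ≤ β r := by
    intro r
    have := hc.2 (Set.mem_univ r) (Set.mem_univ (-r)) (show (0:ℝ) ≤ 1/2 by norm_num)
      (show (0:ℝ) ≤ 1/2 by norm_num) (by norm_num)
    simp only [smul_eq_mul, heven] at this
    rw [show (1/2 * r + 1/2 * -r : ℝ) = 0 by ring, h0] at this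
    linarith
  have habs : β |r| = β r := by
    rcases abs_choice r with h | h <;> rw [h]
    exact heven r
  constructor
  · by_cases h1 : 1 ≤ |r|
    · have hD : ∀ x, HasDerivAt (fun y => β y - y) (deriv β x - 1) x := fun x =>
        (hd x).hasDerivAt.sub (hasDerivAt_id x)
      have := (convex_Ici (1:ℝ)).norm_image_sub_le_of_norm_hasDerivWithin_le
        (f := fun y => β y - y) (C := 0)
        (fun x _ => (hD x).hasDerivWithinAt)
        (fun x hx => by rw [hup x hx]; simp) (Set.mem_Ici.2 le_rfl) (Set.mem_Ici.2 h1)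
      rw [zero_mul, Real.norm_eq_abs] at this
      have h3 := abs_le.1 this
      have := hpos 1
      rw [habs] at h3
      linarith [h3.1]
    · have := hpos r
      linarith
  · have := (convex_univ (𝕜 := ℝ) (E := ℝ)).norm_image_sub_le_of_norm_deriv_le (f := β) (C := 1)
      (fun x _ => hd x) (fun x _ => hd1 x) (Set.mem_univ 0) (Set.mem_univ r)
    rw [h0, sub_zero, sub_zero, one_mul, Real.norm_eq_abs, Real.norm_eq_abs] at this
    exact (le_abs_self _).trans this

/-- Let `A : ℝ → ℝ` be `C²` with second derivative bounded by `M`. Then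
for every `ξ > 0` and all `u, v`,
`|A^{β_ξ}(u,v) − A^{β_ξ}(v,u)| ≤ 2 ‖A''‖_∞ ξ |u − v|`. -/
theorem stmt_9 (β : ℝ → ℝ) (hsmooth : ContDiff ℝ (⊤ : ℕ∞) β) (h0 : β 0 = 0)
    (heven : ∀ r, β (-r) = β r) (hconv : ∀ r, 0 ≤ deriv (deriv β) r)
    (hd1 : ∀ r, |deriv β r| ≤ 1)
    (hup : ∀ r : ℝ, 1 ≤ r → deriv β r = 1)
    (hdown : ∀ r : ℝ, r ≤ -1 → deriv β r = -1)
    (A : ℝ → ℝ) (hA : ContDiff ℝ 2 A)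
    (M : ℝ) (hM : ∀ x, |deriv (deriv A) x| ≤ M)
    (ξ : ℝ) (hξ : 0 < ξ) (u v : ℝ) :
    |fluxBeta β ξ A u v - fluxBeta β ξ A v u| ≤ 2 * M * ξ * |u - v| := by
  have hd : Differentiable ℝ β := hsmooth.differentiable (by simp)
  have hcb : Continuous (deriv β) := hsmooth.continuous_deriv (by simp)
  have hA1 : ContDiff ℝ 1 (deriv A) := ((contDiff_succ_iff_deriv (n := 1)).1 hA).2.2
  have hcA : Continuous (deriv A) := hA1.continuous
  have hcA2 : Continuous (deriv (deriv A)) := hA1.continuous_deriv le_rfl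
  have hg : ∀ r, HasDerivAt (betaXi β ξ) (deriv β (r / ξ)) r := by
    intro r
    have h1 : HasDerivAt (fun y : ℝ => y / ξ) (1 / ξ) r := (hasDerivAt_id r).div_const ξ
    have h2 := ((hd (r / ξ)).hasDerivAt.comp r h1).const_mul ξ
    refine h2.congr_deriv ?_
    field_simp
  have hgd : deriv (betaXi β ξ) = fun r => deriv β (r / ξ) := funext fun r => (hg r).deriv
  have hgc : Continuous (betaXi β ξ) :=
    continuous_iff_continuousAt.2 fun r => (hg r).continuousAt
  have hgdc : Continuous (deriv (betaXi β ξ)) := by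
    rw [hgd]; exact hcb.comp (continuous_id.div_const ξ)
  have hg0 : betaXi β ξ 0 = 0 := by simp [betaXi, h0]
  have hgeven : ∀ r, betaXi β ξ (-r) = betaXi β ξ r := by
    intro r; simp [betaXi, neg_div, heven]
  have hgb : ∀ r, |r| - ξ ≤ betaXi β ξ r ∧ betaXi β ξ r ≤ |r| := by
    intro r
    obtain ⟨h1, h2⟩ := beta_bounds β hsmooth h0 heven hconv hd1 hup (r / ξ)
    have e : ξ * |r / ξ| = |r| := by
      rw [abs_div, abs_of_pos hξ]; field_simp
    have h1' := mul_le_mul_of_nonneg_left h1 hξ.le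
    have h2' := mul_le_mul_of_nonneg_left h2 hξ.le
    rw [mul_sub, e, mul_one] at h1'
    rw [e] at h2'
    exact ⟨h1', h2'⟩
  have hgd' : ∀ r, HasDerivAt (betaXi β ξ) (deriv (betaXi β ξ) r) r := fun r => by
    rw [hgd]; exact hg r
  set g := betaXi β ξ with hgdef
  unfold fluxBeta
  rw [← hgdef, intervalIntegral.integral_symm v u, sub_neg_eq_add,
    ← intervalIntegral.integral_add (Continuous.intervalIntegrable (by fun_prop) _ _)
      (Continuous.intervalIntegrable (by fun_prop) _ _)]
  have hH : ∀ r, HasDerivAt (fun r => (g (r - v) + g (r - u) - g (u - v)) * deriv A r)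
      ((deriv g (r - v) + deriv g (r - u)) * deriv A r
        + (g (r - v) + g (r - u) - g (u - v)) * deriv (deriv A) r) r := by
    intro r
    have h1 : HasDerivAt (fun r => g (r - v)) (deriv g (r - v)) r :=
      (hgd' (r - v)).comp_sub_const r v
    have h2 : HasDerivAt (fun r => g (r - u)) (deriv g (r - u)) r :=
      (hgd' (r - u)).comp_sub_const r u
    exact ((h1.add h2).sub_const (g (u - v))).mul
      ((hA1.differentiable (by simp)) r).hasDerivAt
  have hI := intervalIntegral.integral_eq_sub_of_hasDerivAt (a := v) (b := u)
    (fun r _ => hH r) (Continuous.intervalIntegrable (by fun_prop) _ _)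
  rw [intervalIntegral.integral_add (Continuous.intervalIntegrable (by fun_prop) _ _)
      (Continuous.intervalIntegrable (by fun_prop) _ _)] at hI
  have e1 : g (v - u) = g (u - v) := by rw [← hgeven (u - v), neg_sub]
  simp only [sub_self, hg0, e1, add_zero, zero_add, zero_mul] at hI
  simp only [← add_mul]
  rw [eq_neg_of_add_eq_zero_left hI, abs_neg, ← Real.norm_eq_abs]
  refine intervalIntegral.norm_integral_le_of_norm_le_const (fun r hr => ?_)
  rw [Real.norm_eq_abs, abs_mul]
  have hb : |g (r - v) + g (r - u) - g (u - v)| ≤ 2 * ξ := by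
    have hs : |r - v| + |r - u| = |u - v| := by
      rcases Set.mem_uIoc.1 hr with ⟨ha, hb⟩ | ⟨ha, hb⟩
      · rw [abs_of_nonneg (by linarith), abs_of_nonpos (by linarith),
          abs_of_nonneg (by linarith)]; ring
      · rw [abs_of_nonpos (by linarith), abs_of_nonneg (by linarith),
          abs_of_nonpos (by linarith)]; ring
    obtain ⟨a1, a2⟩ := hgb (r - v)
    obtain ⟨b1, b2⟩ := hgb (r - u)
    obtain ⟨c1, c2⟩ := hgb (u - v)
    rw [abs_le]; constructor <;> linarith
  calc _ ≤ 2 * ξ * M := mul_le_mul hb (hM r) (abs_nonneg _) (by positivity)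
    _ = _ := by ring
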